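/- arXiv:math/9910176 — 2 statements merged into one kernel-verified Lean document; each statement's English description precedes it below -/
import Mathlib

section
/- Let G(x,λ,α,β) = x³ + λ(λ − x) + α + βx. The only point (x,λ,α,β) ∈ ℝ⁴ at which G = 0, ∂G/∂x = 0, ∂G/∂λ = 0 and ∂²G/∂x² = 0 all hold is (0,0,0,0); that is, the unfolding P_TI contains a unique pitchfork point. -/
/-- The simplest universal unfolding `P_TI` of a non-symmetric pitchfork:
`G(x,λ,α,β) = x³ + λ(λ − x) + α + βx`. -/
noncomputable def G (x l a b : ℝ) : ℝ := x^3 + l*(l - x) + a + b*x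

/-- `∂G/∂x` -/
noncomputable def Gx (x l a b : ℝ) : ℝ := deriv (fun t => G t l a b) x
/-- `∂G/∂λ` -/
noncomputable def Gl (x l a b : ℝ) : ℝ := deriv (fun t => G x t a b) l
/-- `∂²G/∂x²` -/
noncomputable def Gxx (x l a b : ℝ) : ℝ := deriv (fun t => Gx t l a b) x
/-- `∂²G/∂x∂λ` -/
noncomputable def Gxl (x l a b : ℝ) : ℝ := deriv (fun t => Gx x t a b) l
/-- `∂²G/∂λ∂x` -/
noncomputable def Glx (x l a b : ℝ) : ℝ := deriv (fun t => Gl t l a b) x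
/-- `∂²G/∂λ²` -/
noncomputable def Gll (x l a b : ℝ) : ℝ := deriv (fun t => Gl x t a b) l
/-- `∂³G/∂x³` -/
noncomputable def Gxxx (x l a b : ℝ) : ℝ := deriv (fun t => Gxx t l a b) x
/-- Determinant of the Hessian of `G` with respect to `(x,λ)`. -/
noncomputable def detH (x l a b : ℝ) : ℝ :=
  Gxx x l a b * Gll x l a b - Gxl x l a b * Glx x l a b

theorem Gx_eq (x l a b : ℝ) : Gx x l a b = 3 * x ^ 2 - l + b := by
  have h := ((((hasDerivAt_id' x).pow 3).add (((hasDerivAt_id' x).const_sub l).const_mul l)).add_const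
    a).add ((hasDerivAt_id' x).const_mul b)
  refine (h.congr_deriv ?_).deriv
  norm_num
  ring

theorem Gl_eq (x l a b : ℝ) : Gl x l a b = 2 * l - x := by
  have h := ((((hasDerivAt_id' l).mul ((hasDerivAt_id' l).sub_const x)).const_add
    (x ^ 3)).add_const a).add_const (b * x)
  refine (h.congr_deriv ?_).deriv
  ring

theorem Gxx_eq (x l a b : ℝ) : Gxx x l a b = 6 * x := by
  have h := ((((hasDerivAt_id' x).pow 2).const_mul 3).sub_const l).add_const b
  simp only [Gxx, Gx_eq]
  refine (h.congr_deriv ?_).deriv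
  norm_num
  ring

/-- `P_TI` contains a unique pitchfork point, at the origin. -/
theorem TI_pitchfork_unique :
    ∀ x l a b : ℝ,
      (G x l a b = 0 ∧ Gx x l a b = 0 ∧ Gl x l a b = 0 ∧ Gxx x l a b = 0) ↔
      (x = 0 ∧ l = 0 ∧ a = 0 ∧ b = 0) := by
  intro x l a b
  rw [Gx_eq, Gl_eq, Gxx_eq, G]
  constructor
  · rintro ⟨hG, hx, hl, hxx⟩
    obtain rfl : x = 0 := by linarith
    obtain rfl : l = 0 := by linarith
    obtain rfl : b = 0 := by linarith
    exact ⟨rfl, rfl, by linarith, rfl⟩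
  · rintro ⟨rfl, rfl, rfl, rfl⟩
    norm_num
end

section
/- Let G(x,λ,α,β) = x³ + λ(λ − x) + α + βx and let β < 1/48, β ≠ 0, with B = √(1 − 48β) > 0. At the point x = (1 − B)/12, λ = (1 − B)/24, α = (1 − B − 24β(3 − 2B))/864 one has G = 0, ∂G/∂x = 0, ∂G/∂λ = 0, and the determinant of the Hessian of G with respect to (x,λ) equals −B < 0 while ∂²G/∂x² = (1 − B)/2 ≠ 0; hence this point is a transcritical point of P_TI. -/
theorem Gxl_eq (x l a b : ℝ) : Gxl x l a b = -1 := by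
  have h : HasDerivAt (fun t => Gx x t a b) (-1) l := by
    simp only [Gx_eq]
    exact ((hasDerivAt_id' l).const_sub (3 * x ^ 2)).add_const b
  exact h.deriv

theorem Glx_eq (x l a b : ℝ) : Glx x l a b = -1 := by
  have h : HasDerivAt (fun t => Gl t l a b) (-1) x := by
    simp only [Gl_eq]
    exact (hasDerivAt_id' x).const_sub (2 * l)
  exact h.deriv

theorem Gll_eq (x l a b : ℝ) : Gll x l a b = 2 := by
  have h : HasDerivAt (fun t => Gl x t a b) 2 l := by
    simp only [Gl_eq]
    simpa using ((hasDerivAt_id' l).const_mul 2).sub_const x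
  exact h.deriv

theorem detH_eq (x l a b : ℝ) : detH x l a b = 12 * x - 1 := by
  rw [detH, Gxx_eq, Gll_eq, Gxl_eq, Glx_eq]
  ring

/-- For `β < 1/48`, `β ≠ 0`, with `B = √(1 − 48β)`, the point
`x = (1−B)/12`, `λ = (1−B)/24`, `α = (1−B−24β(3−2B))/864` is a transcritical point of
`P_TI`. -/
theorem TI_transcritical_point (b : ℝ) (hb1 : b < 1/48) (hb0 : b ≠ 0)
    (B x l a : ℝ) (hB : B = Real.sqrt (1 - 48*b))
    (hx : x = (1 - B)/12) (hl : l = (1 - B)/24)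
    (ha : a = (1 - B - 24*b*(3 - 2*B))/864) :
    B > 0 ∧
    G x l a b = 0 ∧ Gx x l a b = 0 ∧ Gl x l a b = 0 ∧
    detH x l a b = -B ∧ detH x l a b < 0 ∧
    Gxx x l a b = (1 - B)/2 ∧ Gxx x l a b ≠ 0 := by
  have hpos : 0 < B := hB ▸ Real.sqrt_pos.2 (by linarith)
  have hb : b = (1 - B ^ 2) / 48 := by
    rw [hB, Real.sq_sqrt (by linarith)]
    ring
  have hdet : detH x l a b = -B := by
    rw [detH_eq, hx]
    ring
  refine ⟨hpos, ?_, ?_, ?_, hdet, by linarith, ?_, ?_⟩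
  · rw [G, ha, hx, hl, hb]
    ring
  · rw [Gx_eq, hx, hl, hb]
    ring
  · rw [Gl_eq, hx, hl]
    ring
  · rw [Gxx_eq, hx]
    ring
  · intro h
    rw [Gxx_eq, hx] at h
    have hB1 : B = 1 := by linarith
    exact hb0 (by rw [hb, hB1]; norm_num)
end
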